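/- Let N ≥ 2 be an integer and let τ be a point of the complex upper half-plane with E₂^{(N)}(τ) ≠ 0. Then E₂^{(N)}(−1/(Nτ)) ≠ 0, and the Fricke involution interchanges the domain and codomain invariants up to explicit powers of N: a₄(−1/(Nτ)) = N² · a₄′(τ) and a₆(−1/(Nτ)) = −N³ · a₆′(τ). -/

import Mathlib

open Complex UpperHalfPlane Matrix MatrixGroups Filter

/-- `q = e^{2πiτ}`. -/
noncomputable def qExp (τ : ℂ) : ℂ := Complex.exp (2 * Real.pi * Complex.I * τ)

/-- `σ_k(n) = Σ_{d ∣ n} d^k`. -/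
def sigma' (k n : ℕ) : ℕ := ∑ d ∈ n.divisors, d ^ k

/-- Normalized Eisenstein series `E₄(τ) = 1 + 240 Σ_{n≥1} σ₃(n) qⁿ`. -/
noncomputable def E4 (τ : ℂ) : ℂ := 1 + 240 * ∑' n : ℕ+, (sigma' 3 n : ℂ) * qExp τ ^ (n : ℕ)

/-- Normalized Eisenstein series `E₆(τ) = 1 − 504 Σ_{n≥1} σ₅(n) qⁿ`. -/
noncomputable def E6 (τ : ℂ) : ℂ := 1 - 504 * ∑' n : ℕ+, (sigma' 5 n : ℂ) * qExp τ ^ (n : ℕ)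

/-- Normalized weight-2 Eisenstein series `E₂(τ) = 1 − 24 Σ_{n≥1} σ₁(n) qⁿ`. -/
noncomputable def E2 (τ : ℂ) : ℂ := 1 - 24 * ∑' n : ℕ+, (sigma' 1 n : ℂ) * qExp τ ^ (n : ℕ)

/-- `E₂^{(N)}(τ) = (N−1)/24 + Σ_{n≥1} σ₁(n)(qⁿ − N q^{Nn})`. -/
noncomputable def E2N (N : ℕ) (τ : ℂ) : ℂ :=
  ((N : ℂ) - 1) / 24 +
    ∑' n : ℕ+, (sigma' 1 n : ℂ) * (qExp τ ^ (n : ℕ) - (N : ℂ) * qExp τ ^ (N * (n : ℕ)))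

/-- `a₄(τ) = −E₄(τ)/(48 E₂^{(N)}(τ)²)`. -/
noncomputable def a4 (N : ℕ) (τ : ℂ) : ℂ := -E4 τ / (48 * E2N N τ ^ 2)

/-- `a₆(τ) = E₆(τ)/(864 E₂^{(N)}(τ)³)`. -/
noncomputable def a6 (N : ℕ) (τ : ℂ) : ℂ := E6 τ / (864 * E2N N τ ^ 3)

/-- `a₄′(τ) = −E₄(Nτ)/(48 E₂^{(N)}(τ)²)`. -/
noncomputable def a4' (N : ℕ) (τ : ℂ) : ℂ := -E4 ((N : ℂ) * τ) / (48 * E2N N τ ^ 2)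

/-- `a₆′(τ) = E₆(Nτ)/(864 E₂^{(N)}(τ)³)`. -/
noncomputable def a6' (N : ℕ) (τ : ℂ) : ℂ := E6 ((N : ℂ) * τ) / (864 * E2N N τ ^ 3)

lemma sigma'_eq (k n : ℕ) : sigma' k n = ArithmeticFunction.sigma k n := by
  simp [sigma', ArithmeticFunction.sigma_apply]

lemma E2_coe (z : ℍ) : E2 (z : ℂ) = EisensteinSeries.E2 z := by
  simp [E2, EisensteinSeries.E2_eq_tsum_cexp, sigma'_eq, qExp]

lemma bern4 : bernoulli 4 = -1 / 30 := by
  rw [bernoulli_eq_bernoulli'_of_ne_one (by norm_num), bernoulli'_four]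

lemma bern6 : bernoulli 6 = 1 / 42 := by
  have h5 : bernoulli' 5 = 0 := bernoulli'_eq_zero_of_odd (by decide) (by norm_num)
  rw [bernoulli_eq_bernoulli'_of_ne_one (by norm_num), bernoulli'_def]
  simp [Finset.sum_range_succ, h5, Nat.choose]
  norm_num

lemma E4_coe (z : ℍ) : E4 (z : ℂ) = ModularForm.E (by norm_num : 3 ≤ 4) z := by
  rw [EisensteinSeries.q_expansion_bernoulli _ (by decide), bern4]
  simp [E4, sigma'_eq, qExp]
  norm_num

lemma E6_coe (z : ℍ) : E6 (z : ℂ) = ModularForm.E (by norm_num : 3 ≤ 6) z := by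
  rw [EisensteinSeries.q_expansion_bernoulli _ (by decide), bern6]
  simp [E6, sigma'_eq, qExp]
  norm_num

lemma coe_S (z : ℍ) : -1 / (z : ℂ) = ((ModularGroup.S • z : ℍ) : ℂ) := by
  rw [modular_S_smul]
  simp [neg_div, inv_neg]

lemma E_S {k : ℕ} (hk : 3 ≤ k) (z : ℍ) :
    ModularForm.E hk (ModularGroup.S • z) = (z : ℂ) ^ k * ModularForm.E hk z := by
  have h := congrFun (SlashInvariantForm.slash_action_eqn (ModularForm.E hk)
    (ModularGroup.S : GL (Fin 2) ℝ) ⟨ModularGroup.S, rfl⟩) z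
  have h2 := SlashInvariantForm.slash_S_apply (ModularForm.E hk) k z
  rw [← modular_S_smul] at h2
  have h3 : ModularForm.E hk z = _ := h.symm.trans h2
  rw [h3, _root_.zpow_neg, zpow_natCast]
  field_simp [z.ne_zero]

lemma E4_S (z : ℍ) : E4 (-1 / (z : ℂ)) = (z : ℂ) ^ 4 * E4 z := by
  rw [coe_S, E4_coe, E4_coe, E_S]

lemma E6_S (z : ℍ) : E6 (-1 / (z : ℂ)) = (z : ℂ) ^ 6 * E6 z := by
  rw [coe_S, E6_coe, E6_coe, E_S]

lemma E2_S (z : ℍ) : E2 (-1 / (z : ℂ)) =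
    (z : ℂ) ^ 2 * E2 z - (1 / (2 * riemannZeta 2)) * (2 * Real.pi * Complex.I) * z := by
  rw [coe_S, E2_coe, E2_coe]
  have h := EisensteinSeries.G2_S_transform z
  have hz := z.ne_zero
  simp only [EisensteinSeries.E2, Pi.smul_apply, smul_eq_mul]
  rw [h]
  field_simp
  ring

lemma summ (z : ℍ) : Summable fun n : ℕ+ ↦ (sigma' 1 n : ℂ) * qExp z ^ (n : ℕ) := by
  have h := EisensteinSeries.summable_sigma_mul_cexp_pow (k := 2) (by norm_num) z
  have := h.comp_injective PNat.coe_injective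
  simpa [sigma'_eq, qExp, Function.comp_def] using this

lemma E2N_eq (N : ℕ) (z w : ℍ) (hw : (w : ℂ) = N * z) :
    E2N N z = (N * E2 w - E2 z) / 24 := by
  have hq : ∀ n : ℕ, qExp w ^ n = qExp z ^ (N * n) := by
    intro n
    rw [pow_mul, qExp, qExp, ← Complex.exp_nat_mul _ N, hw]
    ring_nf
  have h1 := summ z
  have h2 := summ w
  simp only [hq] at h2
  simp only [E2N, E2, hq]
  have : ∀ n : ℕ+, (sigma' 1 n : ℂ) * (qExp z ^ (n : ℕ) - (N : ℂ) * qExp z ^ (N * (n : ℕ))) =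
      (sigma' 1 n : ℂ) * qExp z ^ (n : ℕ) - N * ((sigma' 1 n : ℂ) * qExp z ^ (N * (n : ℕ))) := by
    intro n; ring
  rw [tsum_congr this, h1.tsum_sub (h2.mul_left _), tsum_mul_left]
  ring

/-- The Fricke involution interchanges the domain and codomain invariants up to explicit
powers of `N`. -/
theorem fricke_swaps_invariants (N : ℕ) (hN : 2 ≤ N) (τ : ℍ)
    (hτ : E2N N (τ : ℂ) ≠ 0) :
    E2N N (-1 / ((N : ℂ) * τ)) ≠ 0 ∧
    a4 N (-1 / ((N : ℂ) * τ)) = (N : ℂ) ^ 2 * a4' N (τ : ℂ) ∧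
    a6 N (-1 / ((N : ℂ) * τ)) = -(N : ℂ) ^ 3 * a6' N (τ : ℂ) := by
  have hN0 : (N : ℂ) ≠ 0 := by exact_mod_cast (by omega : N ≠ 0)
  have hτ0 := τ.ne_zero
  obtain ⟨w, hw⟩ : ∃ w : ℍ, (w : ℂ) = N * τ :=
    ⟨⟨N * τ, by
      have := τ.im_pos
      have hp : (0 : ℝ) < N := by exact_mod_cast (by omega : 0 < N)
      simpa using mul_pos hp this⟩, rfl⟩
  have key : E2N N (-1 / ((N : ℂ) * τ)) = -(N * (τ : ℂ) ^ 2) * E2N N τ := by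
    have h := E2N_eq N (ModularGroup.S • w) (ModularGroup.S • τ) (by
      rw [← coe_S, ← coe_S, hw]; field_simp)
    rw [← coe_S, ← coe_S, E2_S, E2_S] at h
    rw [E2N_eq N τ w hw, ← hw, h, hw]
    ring
  have h4 := E4_S w
  have h6 := E6_S w
  rw [hw] at h4 h6
  refine ⟨?_, ?_, ?_⟩
  · rw [key]
    simp [hN0, hτ0, hτ]
  · rw [a4, a4', key, h4]
    field_simp
  · rw [a6, a6', key, h6]
    field_simp
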